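/- Let w ∈ Ŵ be minuscule with I_w ≠ ∅. The following conditions are equivalent: (i) I_w ⊆ I_v for every minuscule v ∈ Ŵ with I_v ≠ ∅ and v(α₀) + δ = w(α₀) + δ (i.e., I_w is the minimal element of Ab_{τ(I_w)}); (ii) (γ, θ) > 0 for every γ ∈ I_w; (iii) w = w′·s₀ for some w′ ∈ W, where s₀ = s_{α₀}. -/

import Mathlib

open scoped BigOperators

/-- Data of a reduced irreducible crystallographic root system `Δ`, spanning a
`ℚ`-vector space `V` equipped with a Weyl-group-invariant inner product `B`,
together with a chosen system of positive roots `Pos` and the highest root `θ`. -/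
structure RootSystemCtx (V : Type*) [AddCommGroup V] [Module ℚ V] where
  /-- the invariant inner product `( , )` -/
  B : V →ₗ[ℚ] V →ₗ[ℚ] ℚ
  B_symm : ∀ x y : V, B x y = B y x
  B_posdef : ∀ x : V, x ≠ 0 → 0 < B x x
  /-- the set of roots -/
  Δ : Set V
  Δ_finite : Δ.Finite
  Δ_spans : Submodule.span ℚ Δ = ⊤
  zero_notMem_Δ : (0 : V) ∉ Δ
  neg_mem_Δ : ∀ α ∈ Δ, -α ∈ Δ
  reduced : ∀ α ∈ Δ, ∀ c : ℚ, c • α ∈ Δ → c = 1 ∨ c = -1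
  crystallographic : ∀ α ∈ Δ, ∀ β ∈ Δ, ∃ n : ℤ, 2 * B α β / B β β = (n : ℚ)
  reflect_mem : ∀ α ∈ Δ, ∀ β ∈ Δ, β - (2 * B β α / B α α) • α ∈ Δ
  irreducible : ∀ S : Set V, S ⊆ Δ → (∀ α ∈ S, ∀ β ∈ Δ \ S, B α β = 0) → S = ∅ ∨ S = Δ
  /-- the positive roots `Δ⁺` -/
  Pos : Set V
  pos_subset : Pos ⊆ Δ
  mem_pos_or_neg_pos : ∀ α ∈ Δ, α ∈ Pos ∨ -α ∈ Pos
  pos_not_neg : ∀ α ∈ Pos, -α ∉ Pos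
  add_pos_mem : ∀ α ∈ Pos, ∀ β ∈ Pos, α + β ∈ Δ → α + β ∈ Pos
  /-- the highest root `θ` -/
  θ : V
  θ_pos : θ ∈ Pos
  θ_highest : ∀ ν ∈ Δ, θ - ν ∈ AddSubmonoid.closure Pos

namespace RootSystemCtx

variable {V : Type*} [AddCommGroup V] [Module ℚ V] (ctx : RootSystemCtx V)

/-- the simple roots `Π`: indecomposable positive roots -/
def simple : Set V :=
  {α | α ∈ ctx.Pos ∧ ¬∃ β ∈ ctx.Pos, ∃ γ ∈ ctx.Pos, α = β + γ}

/-- `ρ`, the half-sum of all positive roots -/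
noncomputable def ρ : V :=
  (1 / 2 : ℚ) • ∑ α ∈ (ctx.Δ_finite.subset ctx.pos_subset).toFinset, α

/-- the coroot `μ∨ = 2μ/(μ,μ)` -/
noncomputable def coroot (μ : V) : V := (2 / ctx.B μ μ) • μ

/-- `Δ⁺_l`, the long positive roots (roots of the same length as `θ`) -/
def PosLong : Set V := {μ | μ ∈ ctx.Pos ∧ ctx.B μ μ = ctx.B ctx.θ ctx.θ}

/-- `Π_l`, the long simple roots -/
def SimpleLong : Set V := {μ | μ ∈ ctx.simple ∧ ctx.B μ μ = ctx.B ctx.θ ctx.θ}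

/-- the dominance order `μ ≼ ν` on the root lattice: `ν - μ` is a nonnegative
integer combination of positive roots -/
def le (μ ν : V) : Prop := ν - μ ∈ AddSubmonoid.closure ctx.Pos

/-- a (combinatorial) abelian ideal of `Δ⁺` -/
def IsAbelianIdeal (I : Set V) : Prop :=
  I ⊆ ctx.Pos ∧ (∀ μ ∈ I, ∀ ν ∈ I, μ + ν ∉ ctx.Δ) ∧
    ∀ γ ∈ I, ∀ ν ∈ ctx.Pos, γ + ν ∈ ctx.Δ → γ + ν ∈ I

/-- `γ` is a generator of the ideal `I` -/
def IsGenerator (I : Set V) (γ : V) : Prop := γ ∈ I ∧ ∀ α ∈ ctx.Pos, γ - α ∉ I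

/-! ### The affine picture: `V̂ = V ⊕ ℚδ ⊕ ℚλ`, modelled as `V × ℚ × ℚ`,
with `δ = (0,1,0)` and `λ = (0,0,1)`. -/

/-- the embedding of `V` into `V̂` -/
def emb (_ctx : RootSystemCtx V) (v : V) : V × ℚ × ℚ := (v, 0, 0)

/-- the imaginary root `δ` -/
def δhat (_ctx : RootSystemCtx V) : V × ℚ × ℚ := (0, 1, 0)

/-- the affine simple root `α₀ = δ - θ` -/
def alpha0 : V × ℚ × ℚ := (-ctx.θ, 1, 0)

/-- the extension of the inner product to `V̂`, with
`(δ,V)=(λ,V)=(δ,δ)=(λ,λ)=0` and `(δ,λ)=1` -/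
noncomputable def Bhat : (V × ℚ × ℚ) →ₗ[ℚ] (V × ℚ × ℚ) →ₗ[ℚ] ℚ :=
  LinearMap.mk₂ ℚ (fun x y => ctx.B x.1 y.1 + x.2.1 * y.2.2 + x.2.2 * y.2.1)
    (fun x x' y => by
      simp only [Prod.fst_add, Prod.snd_add, map_add, LinearMap.add_apply]; ring)
    (fun c x y => by
      simp only [Prod.smul_fst, Prod.smul_snd, map_smul, LinearMap.smul_apply,
        smul_eq_mul]; ring)
    (fun x y y' => by
      simp only [Prod.fst_add, Prod.snd_add, map_add]; ring)
    (fun c x y => by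
      simp only [Prod.smul_fst, Prod.smul_snd, map_smul, smul_eq_mul]; ring)

/-- the set `Δ̂` of affine real roots -/
def Δhat : Set (V × ℚ × ℚ) := {x | ∃ α ∈ ctx.Δ, ∃ k : ℤ, x = (α, (k : ℚ), 0)}

/-- the set `Δ̂⁺` of positive affine roots -/
def PosHat : Set (V × ℚ × ℚ) :=
  {x | ∃ α ∈ ctx.Pos, x = (α, 0, 0)} ∪
    {x | ∃ α ∈ ctx.Δ, ∃ k : ℤ, 1 ≤ k ∧ x = (α, (k : ℚ), 0)}

/-- the set `Π̂ = Π ∪ {α₀}` of affine simple roots -/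
def SimpleHat : Set (V × ℚ × ℚ) :=
  {x | ∃ α ∈ ctx.simple, x = (α, (0 : ℚ), (0 : ℚ))} ∪ {ctx.alpha0}

/-- the reflection `s_β : x ↦ x − (2(x,β)/(β,β))·β` in `V̂` -/
noncomputable def refl (β : V × ℚ × ℚ) : (V × ℚ × ℚ) ≃ₗ[ℚ] (V × ℚ × ℚ) :=
  if h : ctx.Bhat β β = 0 then LinearEquiv.refl ℚ _
  else
    Module.reflection (x := β) (f := (2 / ctx.Bhat β β) • ctx.Bhat β)
      (by simp only [LinearMap.smul_apply, smul_eq_mul]; field_simp)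

/-- the affine Weyl group `Ŵ`, generated by the reflections `s_β`, `β ∈ Δ̂` -/
def What : Subgroup ((V × ℚ × ℚ) ≃ₗ[ℚ] (V × ℚ × ℚ)) :=
  Subgroup.closure {g | ∃ β ∈ ctx.Δhat, g = ctx.refl β}

/-- the finite Weyl group `W`, generated by the reflections `s_α`, `α ∈ Δ`
(identified with a subgroup of `Ŵ`) -/
def Wfin : Subgroup ((V × ℚ × ℚ) ≃ₗ[ℚ] (V × ℚ × ℚ)) :=
  Subgroup.closure {g | ∃ α ∈ ctx.Δ, g = ctx.refl (α, (0 : ℚ), (0 : ℚ))}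

/-- `N̂(w) = {β ∈ Δ̂⁺ : w(β) ∈ −Δ̂⁺}` -/
def Nhat (w : (V × ℚ × ℚ) ≃ₗ[ℚ] (V × ℚ × ℚ)) : Set (V × ℚ × ℚ) :=
  {β | β ∈ ctx.PosHat ∧ -(w β) ∈ ctx.PosHat}

/-- a minuscule element of `Ŵ`: every element of `N̂(w)` has the form `δ - γ`
with `γ ∈ Δ⁺` -/
def IsMinuscule (w : (V × ℚ × ℚ) ≃ₗ[ℚ] (V × ℚ × ℚ)) : Prop :=
  w ∈ ctx.What ∧ ∀ β ∈ ctx.Nhat w, ∃ γ ∈ ctx.Pos, β = ctx.δhat - ctx.emb γ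

/-- the abelian ideal `I_w` corresponding to a minuscule element `w` -/
def idealOf (w : (V × ℚ × ℚ) ≃ₗ[ℚ] (V × ℚ × ℚ)) : Set V :=
  {γ | γ ∈ ctx.Pos ∧ ctx.δhat - ctx.emb γ ∈ ctx.Nhat w}

/-- the ideal `I` has rootlet `τ(I) = μ`, i.e. `I = I_w` for some minuscule `w`
with `w(α₀) + δ = μ` -/
def HasRootlet (I : Set V) (μ : V) : Prop :=
  ∃ w, ctx.IsMinuscule w ∧ ctx.idealOf w = I ∧ w ctx.alpha0 + ctx.δhat = ctx.emb μ

/-- `Ab_μ`, the set of nonempty abelian ideals with rootlet `μ` -/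
def AbFiber (μ : V) : Set (Set V) := {I | I.Nonempty ∧ ctx.HasRootlet I μ}

/-- `N(u) = {γ ∈ Δ⁺ : u(γ) ∈ −Δ⁺}` for `u` in the finite Weyl group -/
def Nfin (w : (V × ℚ × ℚ) ≃ₗ[ℚ] (V × ℚ × ℚ)) : Set V :=
  {γ | γ ∈ ctx.Pos ∧ -(w (ctx.emb γ)) ∈ ctx.PosHat}

/-- the length `l(u) = #N(u)` of an element of the finite Weyl group -/
noncomputable def lenFin (w : (V × ℚ × ℚ) ≃ₗ[ℚ] (V × ℚ × ℚ)) : ℕ :=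
  (ctx.Nfin w).ncard

end RootSystemCtx

namespace RootSystemCtx

variable {V : Type*} [AddCommGroup V] [Module ℚ V] (ctx : RootSystemCtx V)

lemma ne_zero_of_mem {α : V} (h : α ∈ ctx.Δ) : α ≠ 0 := fun h0 => ctx.zero_notMem_Δ (h0 ▸ h)

lemma norm_pos {α : V} (h : α ∈ ctx.Δ) : 0 < ctx.B α α := ctx.B_posdef α (ctx.ne_zero_of_mem h)

/-- Strict Cauchy–Schwarz for non-proportional roots. -/
lemma cauchy_schwarz_lt {α β : V} (hα : α ∈ ctx.Δ) (hβ : β ∈ ctx.Δ) (h₁ : α ≠ β) (h₂ : α ≠ -β) :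
    ctx.B α β * ctx.B α β < ctx.B α α * ctx.B β β := by
  have hb := ctx.norm_pos hβ
  set t : ℚ := ctx.B α β / ctx.B β β with ht
  have hne : α - t • β ≠ 0 := by
    intro h0
    have h : α = t • β := sub_eq_zero.mp h0
    rcases ctx.reduced β hβ t (h ▸ hα) with h1 | h1
    · exact h₁ (by rw [h, h1, one_smul])
    · exact h₂ (by rw [h, h1, neg_one_smul])
  have hpos := ctx.B_posdef _ hne
  simp only [map_sub, map_smul, LinearMap.sub_apply, LinearMap.smul_apply, smul_eq_mul,
    ctx.B_symm β α] at hpos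
  have htb : t * ctx.B β β = ctx.B α β := by rw [ht]; field_simp
  have hlt : t * ctx.B α β < ctx.B α α := by
    rw [htb] at hpos; linarith
  calc ctx.B α β * ctx.B α β = (t * ctx.B α β) * ctx.B β β := by rw [← htb]; ring
    _ < _ := mul_lt_mul_of_pos_right hlt hb

/-- The Cartan integers of two non-proportional roots with positive inner product. -/
lemma exists_cartan {α β : V} (hα : α ∈ ctx.Δ) (hβ : β ∈ ctx.Δ) (hne : α ≠ β)
    (hpos : 0 < ctx.B α β) :
    ∃ m n : ℤ, 2 * ctx.B α β / ctx.B β β = m ∧ 2 * ctx.B β α / ctx.B α α = n ∧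
      0 < m ∧ 0 < n ∧ m * n < 4 := by
  have ha := ctx.norm_pos hα
  have hb := ctx.norm_pos hβ
  obtain ⟨m, hm⟩ := ctx.crystallographic α hα β hβ
  obtain ⟨n, hn⟩ := ctx.crystallographic β hβ α hα
  have hne' : α ≠ -β := by
    rintro rfl
    simp only [map_neg, LinearMap.neg_apply] at hpos
    linarith
  have hcs := ctx.cauchy_schwarz_lt hα hβ hne hne'
  refine ⟨m, n, hm, hn, ?_, ?_, ?_⟩
  · have : (0 : ℚ) < m := by rw [← hm]; positivity
    exact_mod_cast this
  · have : (0 : ℚ) < n := by rw [← hn, ctx.B_symm β α]; positivity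
    exact_mod_cast this
  · have : (m : ℚ) * n < 4 := by
      rw [← hn, ← hm, ctx.B_symm β α, div_mul_div_comm, div_lt_iff₀ (by positivity)]
      nlinarith
    exact_mod_cast this

lemma root_sub_mem {α β : V} (hα : α ∈ ctx.Δ) (hβ : β ∈ ctx.Δ) (hne : α ≠ β)
    (hpos : 0 < ctx.B α β) : α - β ∈ ctx.Δ := by
  obtain ⟨m, n, hm, hn, hm0, hn0, hmn⟩ := ctx.exists_cartan hα hβ hne hpos
  have h : m = 1 ∨ n = 1 := by
    by_contra! hc
    have h1 : 2 ≤ m := by omega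
    have h2 : 2 ≤ n := by omega
    nlinarith
  rcases h with rfl | rfl
  · have := ctx.reflect_mem β hβ α hα
    rwa [hm, Int.cast_one, one_smul] at this
  · have := ctx.neg_mem_Δ _ (ctx.reflect_mem α hα β hβ)
    rwa [hn, Int.cast_one, one_smul, neg_sub] at this

lemma root_add_mem {α β : V} (hα : α ∈ ctx.Δ) (hβ : β ∈ ctx.Δ) (hne : α ≠ -β)
    (hneg : ctx.B α β < 0) : α + β ∈ ctx.Δ := by
  have := ctx.root_sub_mem hα (ctx.neg_mem_Δ β hβ) hne (by simpa using hneg)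
  rwa [sub_neg_eq_add] at this

/-- A nonempty sum of positive roots is nonzero. -/
lemma multiset_sum_ne_zero (n : ℕ) : ∀ m : Multiset V, m.card = n + 1 →
    (∀ α ∈ m, α ∈ ctx.Pos) → m.sum ≠ 0 := by
  induction n with
  | zero =>
    intro m hm hp h0
    obtain ⟨a, rfl⟩ := Multiset.card_eq_one.mp hm
    have ha := hp a (by simp)
    exact ctx.ne_zero_of_mem (ctx.pos_subset ha) (by simpa using h0)
  | succ n ih =>
    intro m hm hp h0
    obtain ⟨a, ham⟩ := Multiset.exists_mem_of_ne_zero (s := m) (by rintro rfl; simp at hm)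
    obtain ⟨m', rfl⟩ := Multiset.exists_cons_of_mem ham
    have ha := hp a (by simp)
    have haa := ctx.norm_pos (ctx.pos_subset ha)
    rw [Multiset.sum_cons] at h0
    have hex : ∃ b ∈ m', ctx.B a b < 0 := by
      by_contra! hc
      have h1 : 0 ≤ ctx.B a m'.sum := by
        rw [map_multiset_sum]
        exact Multiset.sum_nonneg (by simpa using hc)
      rw [eq_neg_of_add_eq_zero_right h0, map_neg] at h1
      linarith
    obtain ⟨b, hb, hab⟩ := hex
    obtain ⟨m'', rfl⟩ := Multiset.exists_cons_of_mem hb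
    have hbp := hp b (by simp)
    have hne : a ≠ -b := by
      rintro rfl
      exact ctx.pos_not_neg b hbp ha
    have hab' := ctx.add_pos_mem a ha b hbp
      (ctx.root_add_mem (ctx.pos_subset ha) (ctx.pos_subset hbp) hne hab)
    refine ih ((a + b) ::ₘ m'') (by simpa using hm) ?_ ?_
    · intro c hc
      rcases Multiset.mem_cons.mp hc with rfl | hc
      · exact hab'
      · exact hp c (by simp [hc])
    · rw [Multiset.sum_cons] at h0 ⊢
      rw [add_assoc]; exact h0

/-- The cone of positive roots is pointed. -/
lemma add_ne_zero_of_mem_closure {p α : V} (hp : p ∈ AddSubmonoid.closure ctx.Pos)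
    (hα : α ∈ ctx.Pos) : p + α ≠ 0 := by
  obtain ⟨m, hm, rfl⟩ := AddSubmonoid.exists_multiset_of_mem_closure hp
  rw [add_comm, ← Multiset.sum_cons]
  refine ctx.multiset_sum_ne_zero m.card _ (by simp) ?_
  intro c hc
  rcases Multiset.mem_cons.mp hc with rfl | hc
  · exact hα
  · exact hm c hc

lemma eq_zero_of_mem_closure {p q : V} (hp : p ∈ AddSubmonoid.closure ctx.Pos)
    (hq : q ∈ AddSubmonoid.closure ctx.Pos) (h : p + q = 0) : p = 0 := by
  obtain ⟨m, hm, rfl⟩ := AddSubmonoid.exists_multiset_of_mem_closure hp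
  by_contra h0
  obtain ⟨a, ham⟩ := Multiset.exists_mem_of_ne_zero (s := m) (by rintro rfl; simp at h0)
  obtain ⟨m', rfl⟩ := Multiset.exists_cons_of_mem ham
  refine ctx.add_ne_zero_of_mem_closure (p := m'.sum + q) (α := a) ?_ (hm a (by simp)) ?_
  · exact AddSubmonoid.add_mem _ (AddSubmonoid.multiset_sum_mem _ _
      fun c hc => AddSubmonoid.subset_closure (hm c (by simp [hc]))) hq
  · rw [← h, Multiset.sum_cons]; abel

lemma pos_of_mem_closure {α : V} (hα : α ∈ ctx.Δ) (h : α ∈ AddSubmonoid.closure ctx.Pos) :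
    α ∈ ctx.Pos := by
  rcases ctx.mem_pos_or_neg_pos α hα with h1 | h1
  · exact h1
  · exact absurd (add_neg_cancel α) (ctx.add_ne_zero_of_mem_closure h h1)

/-- The highest root is dominant. -/
lemma theta_dominant {α : V} (hα : α ∈ ctx.Pos) : 0 ≤ ctx.B α ctx.θ := by
  by_contra! hlt
  have hne : α ≠ -ctx.θ := by
    rintro rfl
    exact ctx.pos_not_neg _ ctx.θ_pos hα
  have h := ctx.θ_highest _
    (ctx.root_add_mem (ctx.pos_subset hα) (ctx.pos_subset ctx.θ_pos) hne hlt)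
  exact ctx.add_ne_zero_of_mem_closure h hα (by abel)

/-- A positive root other than `θ` has pairing `0` or `1` with `θ∨`. -/
lemma pairing_theta {α : V} (hα : α ∈ ctx.Pos) (hne : α ≠ ctx.θ) :
    2 * ctx.B α ctx.θ / ctx.B ctx.θ ctx.θ = 0 ∨ 2 * ctx.B α ctx.θ / ctx.B ctx.θ ctx.θ = 1 := by
  have hθ := ctx.pos_subset ctx.θ_pos
  have ht := ctx.norm_pos hθ
  have hd := ctx.theta_dominant hα
  obtain ⟨n, hn⟩ := ctx.crystallographic α (ctx.pos_subset hα) _ hθ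
  have h0 : 0 ≤ n := by
    have : (0 : ℚ) ≤ n := by rw [← hn]; positivity
    exact_mod_cast this
  by_cases h2 : 2 ≤ n
  · exfalso
    have hr := ctx.neg_mem_Δ _ (ctx.reflect_mem _ hθ α (ctx.pos_subset hα))
    rw [hn] at hr
    have h1 := ctx.θ_highest _ hr
    have h3 := ctx.θ_highest _ (ctx.pos_subset hα)
    obtain ⟨k, hk⟩ := Int.eq_ofNat_of_zero_le (show 0 ≤ n - 2 by omega)
    obtain rfl : n = k + 2 := by omega
    have h4 : (k : ℕ) • ctx.θ ∈ AddSubmonoid.closure ctx.Pos :=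
      AddSubmonoid.nsmul_mem _ (AddSubmonoid.subset_closure ctx.θ_pos) k
    have := ctx.eq_zero_of_mem_closure h3 (AddSubmonoid.add_mem _ h1 h4) (by
      rw [← Nat.cast_smul_eq_nsmul ℚ]
      push_cast
      module)
    exact hne (sub_eq_zero.mp this).symm
  · have : n = 0 ∨ n = 1 := by omega
    rcases this with rfl | rfl
    · left; simpa using hn
    · right; simpa using hn

lemma coroot_pairing {α β : V} (hα : α ∈ ctx.Δ) (hβ : β ∈ ctx.Δ) :
    ∃ n : ℤ, ctx.B (ctx.coroot α) β = n := by
  obtain ⟨n, hn⟩ := ctx.crystallographic β hβ α hα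
  refine ⟨n, ?_⟩
  rw [← hn, coroot, map_smul, LinearMap.smul_apply, smul_eq_mul, ctx.B_symm α β]
  ring

/-- The coroot lattice. -/
def corootLattice : AddSubgroup V := AddSubgroup.closure (ctx.coroot '' ctx.Δ)

lemma coroot_mem {α : V} (hα : α ∈ ctx.Δ) : ctx.coroot α ∈ ctx.corootLattice :=
  AddSubgroup.subset_closure ⟨α, hα, rfl⟩

lemma coroot_neg (α : V) : ctx.coroot (-α) = -ctx.coroot α := by
  simp [coroot]

lemma corootLattice_pairing {x β : V} (hx : x ∈ ctx.corootLattice) (hβ : β ∈ ctx.Δ) :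
    ∃ n : ℤ, ctx.B x β = n := by
  induction hx using AddSubgroup.closure_induction with
  | mem x hx =>
    obtain ⟨α, hα, rfl⟩ := hx
    exact ctx.coroot_pairing hα hβ
  | zero => exact ⟨0, by simp⟩
  | add x y _ _ hx hy =>
    obtain ⟨m, hm⟩ := hx
    obtain ⟨n, hn⟩ := hy
    exact ⟨m + n, by simp [hm, hn]⟩
  | neg x _ hx =>
    obtain ⟨m, hm⟩ := hx
    exact ⟨-m, by simp [hm]⟩

lemma exists_multiset_of_mem_corootLattice {x : V} (hx : x ∈ ctx.corootLattice) :
    ∃ m : Multiset V, (∀ α ∈ m, α ∈ ctx.Δ) ∧ (m.map ctx.coroot).sum = x := by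
  induction hx using AddSubgroup.closure_induction with
  | mem x hx =>
    obtain ⟨α, hα, rfl⟩ := hx
    exact ⟨{α}, by simpa using hα, by simp⟩
  | zero => exact ⟨0, by simp, by simp⟩
  | add x y _ _ hx hy =>
    obtain ⟨m, hm, rfl⟩ := hx
    obtain ⟨n, hn, rfl⟩ := hy
    refine ⟨m + n, fun α h => ?_, by simp⟩
    rcases Multiset.mem_add.mp h with h | h
    exacts [hm α h, hn α h]
  | neg x _ hx =>
    obtain ⟨m, hm, rfl⟩ := hx
    refine ⟨m.map Neg.neg, fun α h => ?_, ?_⟩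
    · obtain ⟨β, hβ, rfl⟩ := Multiset.mem_map.mp h
      exact ctx.neg_mem_Δ β (hm β hβ)
    · rw [Multiset.map_map, ← Multiset.sum_map_neg']
      simp [coroot_neg]

lemma eq_zero_of_multiset (n : ℕ) : ∀ m : Multiset V, m.card = n → (∀ α ∈ m, α ∈ ctx.Δ) →
    (∀ β ∈ ctx.Δ, ctx.B (m.map ctx.coroot).sum β ≤ 1) → (m.map ctx.coroot).sum = 0 := by
  induction n with
  | zero =>
    intro m hm _ _
    simp [Multiset.card_eq_zero.mp hm]
  | succ n ih =>
    intro m hm hΔ hle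
    by_contra h0
    set x := (m.map ctx.coroot).sum with hx
    have hxx := ctx.B_posdef x h0
    have hex : ∃ α ∈ m, 0 < ctx.B x (ctx.coroot α) := by
      by_contra! hc
      have : ctx.B x x ≤ 0 := by
        conv_lhs => rw [hx]
        rw [← hx, map_multiset_sum, Multiset.map_map]
        rw [← neg_nonneg, ← Multiset.sum_map_neg']
        refine Multiset.sum_nonneg ?_
        simpa using hc
      linarith
    obtain ⟨α, hα, hpos⟩ := hex
    have hαΔ := hΔ α hα
    have haa := ctx.norm_pos hαΔ
    obtain ⟨m', rfl⟩ := Multiset.exists_cons_of_mem hα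
    have hxα : ctx.B x α = 1 := by
      have h1 : 0 < ctx.B x α := by
        rw [coroot, map_smul, smul_eq_mul] at hpos
        exact pos_of_mul_pos_right hpos (by positivity)
      have hxm : x ∈ ctx.corootLattice := AddSubgroup.multiset_sum_mem _ _ fun c hc => by
        obtain ⟨d, hd, rfl⟩ := Multiset.mem_map.mp hc
        exact ctx.coroot_mem (hΔ d hd)
      obtain ⟨k, hk⟩ := ctx.corootLattice_pairing hxm hαΔ
      have h2 := hle α hαΔ
      rw [hk] at h1 h2 ⊢
      have : 0 < k := by exact_mod_cast h1
      have : k ≤ 1 := by exact_mod_cast h2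
      have : k = 1 := by omega
      simp [this]
    have hsum : (m'.map ctx.coroot).sum = x - ctx.coroot α := by
      rw [hx, Multiset.map_cons, Multiset.sum_cons, add_sub_cancel_left]
    have hcor : ctx.B (ctx.coroot α) α = 2 := by
      rw [coroot, map_smul, LinearMap.smul_apply, smul_eq_mul]; field_simp
    have hzero := ih m' (by simpa using hm) (fun c hc => hΔ c (by simp [hc])) (by
      intro β hβ
      have h := hle _ (ctx.reflect_mem α hαΔ β hβ)
      rw [map_sub, map_smul, hxα, smul_eq_mul, mul_one] at h
      rw [hsum, map_sub, LinearMap.sub_apply, coroot, map_smul, LinearMap.smul_apply, smul_eq_mul,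
        ctx.B_symm α β]
      linarith [show 2 * ctx.B β α / ctx.B α α = 2 / ctx.B α α * ctx.B β α by ring])
    rw [hsum] at hzero
    have hx2 : x = ctx.coroot α := sub_eq_zero.mp hzero
    rw [hx2, hcor] at hxα
    norm_num at hxα

/-- The coroot lattice contains no nonzero minuscule coweight. -/
lemma eq_zero_of_pairing_le_one {x : V} (hx : x ∈ ctx.corootLattice)
    (h : ∀ β ∈ ctx.Δ, ctx.B x β ≤ 1) : x = 0 := by
  obtain ⟨m, hm, rfl⟩ := ctx.exists_multiset_of_mem_corootLattice hx
  exact ctx.eq_zero_of_multiset _ m rfl hm h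

end RootSystemCtx

namespace RootSystemCtx

variable {V : Type*} [AddCommGroup V] [Module ℚ V] (ctx : RootSystemCtx V)

/-- The reflection of `V` in `α`. -/
noncomputable def reflV (α : V) : V ≃ₗ[ℚ] V :=
  if h : ctx.B α α = 0 then LinearEquiv.refl ℚ V
  else
    Module.reflection (x := α) (f := (2 / ctx.B α α) • ctx.B α)
      (by simp only [LinearMap.smul_apply, smul_eq_mul]; field_simp)

lemma reflV_apply {α : V} (hα : α ∈ ctx.Δ) (v : V) :
    ctx.reflV α v = v - (2 * ctx.B v α / ctx.B α α) • α := by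
  have h := (ctx.norm_pos hα).ne'
  rw [reflV, dif_neg h, Module.reflection_apply, LinearMap.smul_apply, smul_eq_mul,
    ctx.B_symm α v]
  congr 2
  ring

lemma reflV_mem {α β : V} (hα : α ∈ ctx.Δ) (hβ : β ∈ ctx.Δ) : ctx.reflV α β ∈ ctx.Δ := by
  rw [ctx.reflV_apply hα]
  exact ctx.reflect_mem α hα β hβ

lemma reflV_self {α : V} (hα : α ∈ ctx.Δ) : ctx.reflV α α = -α := by
  have h := (ctx.norm_pos hα).ne'
  rw [ctx.reflV_apply hα, mul_div_assoc, div_self h]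
  module

lemma reflV_neg {α : V} (hα : α ∈ ctx.Δ) : ctx.reflV (-α) = ctx.reflV α := by
  ext v
  rw [ctx.reflV_apply hα, ctx.reflV_apply (ctx.neg_mem_Δ α hα)]
  simp [neg_div]

lemma reflV_isometry {α : V} (hα : α ∈ ctx.Δ) (x y : V) :
    ctx.B (ctx.reflV α x) (ctx.reflV α y) = ctx.B x y := by
  have h := (ctx.norm_pos hα).ne'
  rw [ctx.reflV_apply hα, ctx.reflV_apply hα]
  simp only [map_sub, map_smul, LinearMap.sub_apply, LinearMap.smul_apply, smul_eq_mul,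
    ctx.B_symm α y]
  field_simp
  ring

lemma reflV_mul_self {α : V} (hα : α ∈ ctx.Δ) : ctx.reflV α * ctx.reflV α = 1 := by
  ext v
  have h := (ctx.norm_pos hα).ne'
  rw [LinearEquiv.mul_apply, ctx.reflV_apply hα v, map_sub, map_smul, ctx.reflV_self hα,
    ctx.reflV_apply hα v]
  simp

lemma reflV_inv {α : V} (hα : α ∈ ctx.Δ) : (ctx.reflV α)⁻¹ = ctx.reflV α :=
  inv_eq_of_mul_eq_one_left (ctx.reflV_mul_self hα)

/-- The Weyl group acting on `V`. -/
def weyl : Subgroup (V ≃ₗ[ℚ] V) := Subgroup.closure (ctx.reflV '' ctx.Δ)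

lemma reflV_mem_weyl {α : V} (hα : α ∈ ctx.Δ) : ctx.reflV α ∈ ctx.weyl :=
  Subgroup.subset_closure ⟨α, hα, rfl⟩

lemma weyl_isometry {g : V ≃ₗ[ℚ] V} (hg : g ∈ ctx.weyl) : ∀ x y, ctx.B (g x) (g y) = ctx.B x y := by
  induction hg using Subgroup.closure_induction with
  | mem g hg =>
    obtain ⟨α, hα, rfl⟩ := hg
    exact ctx.reflV_isometry hα
  | one => simp
  | mul g h _ _ ihg ihh =>
    intro x y
    rw [LinearEquiv.mul_apply, LinearEquiv.mul_apply, ihg, ihh]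
  | inv g _ ih =>
    intro x y
    rw [← ih]
    simp

lemma weyl_mem {g : V ≃ₗ[ℚ] V} (hg : g ∈ ctx.weyl) : ∀ α ∈ ctx.Δ, g α ∈ ctx.Δ := by
  rw [weyl] at hg
  induction hg using Subgroup.closure_induction'' with
  | mem g hg =>
    obtain ⟨β, hβ, rfl⟩ := hg
    exact fun α hα => ctx.reflV_mem hβ hα
  | inv_mem g hg =>
    obtain ⟨β, hβ, rfl⟩ := hg
    rw [ctx.reflV_inv hβ]
    exact fun α hα => ctx.reflV_mem hβ hα
  | one => simp
  | mul g h _ _ ihg ihh => exact fun α hα => ihg _ (ihh α hα)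

lemma weyl_inv_adjoint {g : V ≃ₗ[ℚ] V} (hg : g ∈ ctx.weyl) (x y : V) :
    ctx.B (g⁻¹ x) y = ctx.B x (g y) := by
  rw [← ctx.weyl_isometry hg]
  simp

lemma weyl_coroot {g : V ≃ₗ[ℚ] V} (hg : g ∈ ctx.weyl) (α : V) :
    g (ctx.coroot α) = ctx.coroot (g α) := by
  rw [coroot, coroot, map_smul, ctx.weyl_isometry hg]

lemma weyl_corootLattice {g : V ≃ₗ[ℚ] V} (hg : g ∈ ctx.weyl) {x : V}
    (hx : x ∈ ctx.corootLattice) : g x ∈ ctx.corootLattice := by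
  rw [corootLattice] at hx
  induction hx using AddSubgroup.closure_induction with
  | mem x hx =>
    obtain ⟨α, hα, rfl⟩ := hx
    rw [ctx.weyl_coroot hg]
    exact ctx.coroot_mem (ctx.weyl_mem hg α hα)
  | zero => rw [map_zero]; exact zero_mem _
  | add x y _ _ hx hy => rw [map_add]; exact add_mem hx hy
  | neg x _ hx => rw [map_neg]; exact neg_mem hx

lemma reflV_conj {g : V ≃ₗ[ℚ] V} (hg : g ∈ ctx.weyl) {α : V} (hα : α ∈ ctx.Δ) :
    ctx.reflV (g α) * g = g * ctx.reflV α := by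
  ext v
  rw [LinearEquiv.mul_apply, LinearEquiv.mul_apply, ctx.reflV_apply (ctx.weyl_mem hg α hα),
    ctx.reflV_apply hα, ctx.weyl_isometry hg, ctx.weyl_isometry hg, map_sub, map_smul]

/-- Induction on positive roots along the dominance order. -/
lemma pos_induction {P : V → Prop}
    (h : ∀ α ∈ ctx.Pos, (∀ β ∈ ctx.Pos, α - β ∈ AddSubmonoid.closure ctx.Pos → β ≠ α → P β) → P α)
    {α : V} (hα : α ∈ ctx.Pos) : P α := by
  induction hn : {β | β ∈ ctx.Pos ∧ α - β ∈ AddSubmonoid.closure ctx.Pos}.ncard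
    using Nat.strong_induction_on generalizing α with
  | _ n ih =>
    refine h α hα fun β hβ hle hne => ih _ ?_ hβ rfl
    rw [← hn]
    refine Set.ncard_lt_ncard ⟨fun γ hγ => ⟨hγ.1, ?_⟩, fun hsub => ?_⟩
      (ctx.Δ_finite.subset fun γ hγ => ctx.pos_subset hγ.1)
    · rw [← sub_add_sub_cancel α β γ]
      exact add_mem hle hγ.2
    · have h1 := (hsub (show α ∈ {β | β ∈ ctx.Pos ∧ α - β ∈ AddSubmonoid.closure ctx.Pos} from
        ⟨hα, by rw [sub_self]; exact zero_mem _⟩)).2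
      exact hne (sub_eq_zero.mp (ctx.eq_zero_of_mem_closure h1 hle (by abel)))

lemma simple_root {α : V} (h : α ∈ ctx.simple) : α ∈ ctx.Δ := ctx.pos_subset h.1

lemma mem_closure_simple {α : V} (hα : α ∈ ctx.Pos) :
    α ∈ AddSubmonoid.closure ctx.simple := by
  refine ctx.pos_induction (P := fun α => α ∈ AddSubmonoid.closure ctx.simple) ?_ hα
  intro α hα ih
  by_cases hs : α ∈ ctx.simple
  · exact AddSubmonoid.subset_closure hs
  · have hex : ∃ β ∈ ctx.Pos, ∃ γ ∈ ctx.Pos, α = β + γ := by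
      by_contra hc
      exact hs ⟨hα, hc⟩
    obtain ⟨β, hβ, γ, hγ, rfl⟩ := hex
    have hβ0 := ctx.ne_zero_of_mem (ctx.pos_subset hβ)
    have hγ0 := ctx.ne_zero_of_mem (ctx.pos_subset hγ)
    refine add_mem (ih β hβ ?_ ?_) (ih γ hγ ?_ ?_)
    · rw [add_sub_cancel_left]; exact AddSubmonoid.subset_closure hγ
    · simpa using hγ0
    · rw [add_sub_cancel_right]; exact AddSubmonoid.subset_closure hβ
    · simpa using hβ0

lemma exists_simple_pairing_pos {α : V} (hα : α ∈ ctx.Pos) :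
    ∃ β ∈ ctx.simple, 0 < ctx.B α β := by
  by_contra! hc
  obtain ⟨m, hm, hs⟩ := AddSubmonoid.exists_multiset_of_mem_closure (ctx.mem_closure_simple hα)
  have h1 : 0 ≤ -ctx.B α m.sum := by
    rw [map_multiset_sum, ← Multiset.sum_map_neg']
    refine Multiset.sum_nonneg ?_
    simpa using fun a ha => hc a (hm a ha)
  have := ctx.norm_pos (ctx.pos_subset hα)
  rw [hs] at h1
  linarith

lemma sub_simple_pos {α β : V} (hβ : β ∈ ctx.simple) (hα : α ∈ ctx.Pos) (h : α - β ∈ ctx.Δ) :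
    α - β ∈ ctx.Pos := by
  rcases ctx.mem_pos_or_neg_pos _ h with h1 | h1
  · exact h1
  · exact absurd ⟨α, hα, _, h1, by abel⟩ hβ.2

/-- A simple reflection permutes the other positive roots. -/
lemma reflV_simple_pos {α β : V} (hβ : β ∈ ctx.simple) (hα : α ∈ ctx.Pos) (hne : α ≠ β) :
    ctx.reflV β α ∈ ctx.Pos := by
  have hβΔ := ctx.simple_root hβ
  have hαΔ := ctx.pos_subset hα
  have hbb := ctx.norm_pos hβΔ
  have hr := ctx.reflV_mem hβΔ hαΔ
  rcases le_or_gt (ctx.B α β) 0 with hle | hgt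
  · refine ctx.pos_of_mem_closure hr ?_
    rw [ctx.reflV_apply hβΔ]
    obtain ⟨n, hn⟩ := ctx.crystallographic α hαΔ β hβΔ
    have h0 : n ≤ 0 := by
      have : (n : ℚ) ≤ 0 := by
        rw [← hn]
        exact div_nonpos_of_nonpos_of_nonneg (by linarith) hbb.le
      exact_mod_cast this
    obtain ⟨k, hk⟩ := Int.eq_ofNat_of_zero_le (show 0 ≤ -n by omega)
    obtain rfl : n = -k := by omega
    have h2 : α - ((-(k : ℤ) : ℤ) : ℚ) • β = α + k • β := by
      rw [← Nat.cast_smul_eq_nsmul ℚ]; push_cast; module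
    rw [hn, h2]
    exact add_mem (AddSubmonoid.subset_closure hα)
      (AddSubmonoid.nsmul_mem _ (AddSubmonoid.subset_closure hβ.1) k)
  · obtain ⟨m, n, hm, -, hm0, hn0, hmn⟩ := ctx.exists_cartan hαΔ hβΔ hne hgt
    have hm3 : m ≤ 3 := by nlinarith
    have hs := ctx.root_sub_mem hαΔ hβΔ hne hgt
    have hs' := ctx.reflV_mem hβΔ hs
    rw [map_sub, ctx.reflV_self hβΔ] at hs'
    rw [ctx.reflV_apply hβΔ, hm] at hr hs' ⊢
    have p1 := ctx.sub_simple_pos hβ hα hs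
    obtain rfl | rfl | rfl : m = 1 ∨ m = 2 ∨ m = 3 := by omega
    · simpa using p1
    · have e : α - ((2 : ℤ) : ℚ) • β = α - β - β := by push_cast; module
      rw [e] at hr ⊢
      exact ctx.sub_simple_pos hβ p1 hr
    · have e : α - ((3 : ℤ) : ℚ) • β = α - β - β - β := by push_cast; module
      have e' : α - ((3 : ℤ) : ℚ) • β - -β = α - β - β := by push_cast; module
      rw [e'] at hs'
      rw [e] at hr ⊢
      exact ctx.sub_simple_pos hβ (ctx.sub_simple_pos hβ p1 hs') hr

lemma reflV_pos_mem_closure {α : V} (hα : α ∈ ctx.Pos) :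
    ctx.reflV α ∈ Subgroup.closure (ctx.reflV '' ctx.simple) := by
  refine ctx.pos_induction
    (P := fun α => ctx.reflV α ∈ Subgroup.closure (ctx.reflV '' ctx.simple)) ?_ hα
  intro α hα ih
  by_cases hs : α ∈ ctx.simple
  · exact Subgroup.subset_closure ⟨α, hs, rfl⟩
  obtain ⟨β, hβ, hpos⟩ := ctx.exists_simple_pairing_pos hα
  have hβΔ := ctx.simple_root hβ
  have hαΔ := ctx.pos_subset hα
  have hne : α ≠ β := by rintro rfl; exact hs hβ
  have hp := ctx.reflV_simple_pos hβ hα hne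
  obtain ⟨m, n, hm, -, hm0, -, -⟩ := ctx.exists_cartan hαΔ hβΔ hne hpos
  obtain ⟨k, rfl⟩ := Int.eq_ofNat_of_zero_le hm0.le
  have hsub : α - ctx.reflV β α = k • β := by
    rw [ctx.reflV_apply hβΔ, hm, ← Nat.cast_smul_eq_nsmul ℚ]; push_cast; module
  have h1 := ih _ hp
    (by rw [hsub]; exact AddSubmonoid.nsmul_mem _ (AddSubmonoid.subset_closure hβ.1) k)
    (by
      intro h
      rw [h, sub_self, eq_comm, ← Nat.cast_smul_eq_nsmul ℚ, smul_eq_zero] at hsub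
      rcases hsub with h | h
      · have : k = 0 := by exact_mod_cast h
        omega
      · exact ctx.ne_zero_of_mem hβΔ h)
  have hβm : ctx.reflV β ∈ Subgroup.closure (ctx.reflV '' ctx.simple) :=
    Subgroup.subset_closure ⟨β, hβ, rfl⟩
  have hconj := ctx.reflV_conj (ctx.reflV_mem_weyl hβΔ) hαΔ
  have : ctx.reflV α = ctx.reflV β * (ctx.reflV (ctx.reflV β α) * ctx.reflV β) := by
    rw [hconj, ← mul_assoc, ctx.reflV_mul_self hβΔ, one_mul]
  rw [this]
  exact mul_mem hβm (mul_mem h1 hβm)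

/-- The Weyl group is generated by the simple reflections. -/
lemma exists_list_of_mem_weyl {g : V ≃ₗ[ℚ] V} (hg : g ∈ ctx.weyl) :
    ∃ l : List V, (∀ α ∈ l, α ∈ ctx.simple) ∧ (l.map ctx.reflV).prod = g := by
  have hle : ctx.weyl ≤ Subgroup.closure (ctx.reflV '' ctx.simple) := by
    rw [weyl, Subgroup.closure_le]
    rintro _ ⟨α, hα, rfl⟩
    rcases ctx.mem_pos_or_neg_pos α hα with h | h
    · exact ctx.reflV_pos_mem_closure h
    · rw [← ctx.reflV_neg hα]
      exact ctx.reflV_pos_mem_closure h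
  replace hg := hle hg
  clear hle
  have key : ∀ α ∈ ctx.simple, ∃ l : List V, (∀ α ∈ l, α ∈ ctx.simple) ∧
      (l.map ctx.reflV).prod = ctx.reflV α := fun α hα => ⟨[α], by simpa using hα, by simp⟩
  induction hg using Subgroup.closure_induction'' with
  | mem g hg =>
    obtain ⟨α, hα, rfl⟩ := hg
    exact key α hα
  | inv_mem g hg =>
    obtain ⟨α, hα, rfl⟩ := hg
    rw [ctx.reflV_inv (ctx.simple_root hα)]
    exact key α hα
  | one => exact ⟨[], by simp, by simp⟩
  | mul g h _ _ ihg ihh =>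
    obtain ⟨l, hl, rfl⟩ := ihg
    obtain ⟨l', hl', rfl⟩ := ihh
    refine ⟨l ++ l', fun α h => ?_, by simp⟩
    rcases List.mem_append.mp h with h | h
    exacts [hl α h, hl' α h]

lemma list_prod_mem_weyl {l : List V} (hl : ∀ α ∈ l, α ∈ ctx.simple) :
    (l.map ctx.reflV).prod ∈ ctx.weyl := by
  refine list_prod_mem fun g hg => ?_
  obtain ⟨α, hα, rfl⟩ := List.mem_map.mp hg
  exact ctx.reflV_mem_weyl (ctx.simple_root (hl α hα))

/-- The exchange condition. -/
lemma exchange {β : V} (hβ : β ∈ ctx.simple) : ∀ l : List V, (∀ α ∈ l, α ∈ ctx.simple) →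
    -((l.map ctx.reflV).prod β) ∈ ctx.Pos →
    ∃ l' : List V, (∀ α ∈ l', α ∈ ctx.simple) ∧ l'.length + 1 = l.length ∧
      (l.map ctx.reflV).prod * ctx.reflV β = (l'.map ctx.reflV).prod := by
  intro l
  induction l with
  | nil => exact fun _ h => absurd (by simpa using h) (ctx.pos_not_neg β hβ.1)
  | cons a t ih =>
    intro hl hneg
    have hβΔ := ctx.simple_root hβ
    have ha : a ∈ ctx.simple := hl a (by simp)
    have ht : ∀ α ∈ t, α ∈ ctx.simple := fun α h => hl α (by simp [h])
    have hp := ctx.list_prod_mem_weyl ht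
    set p := (t.map ctx.reflV).prod with hpd
    rw [List.map_cons, List.prod_cons, ← hpd] at hneg ⊢
    rw [LinearEquiv.mul_apply] at hneg
    rcases ctx.mem_pos_or_neg_pos _ (ctx.weyl_mem hp β hβΔ) with h | h
    · have heq : p β = a := by
        by_contra hne
        exact ctx.pos_not_neg _ (ctx.reflV_simple_pos ha h hne) hneg
      refine ⟨t, ht, by simp, ?_⟩
      rw [← heq, ctx.reflV_conj hp hβΔ, mul_assoc, ctx.reflV_mul_self hβΔ, mul_one]
    · obtain ⟨l', hl', hlen, heq⟩ := ih ht h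
      refine ⟨a :: l', fun α hα => ?_, by simp [hlen], by simp [mul_assoc, heq]⟩
      rcases List.mem_cons.mp hα with rfl | hα
      exacts [ha, hl' α hα]

/-- The Weyl group acts freely on positive systems. -/
lemma eq_one_of_preserves_pos {g : V ≃ₗ[ℚ] V} (hg : g ∈ ctx.weyl)
    (h : ∀ α ∈ ctx.Pos, g α ∈ ctx.Pos) : g = 1 := by
  obtain ⟨l, hl, rfl⟩ := ctx.exists_list_of_mem_weyl hg
  clear hg
  induction hn : l.length using Nat.strong_induction_on generalizing l with
  | _ n ih =>
    rcases List.eq_nil_or_concat l with rfl | ⟨t, β, rfl⟩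
    · simp
    · rw [List.concat_eq_append] at *
      have hβ : β ∈ ctx.simple := hl β (by simp)
      have ht : ∀ α ∈ t, α ∈ ctx.simple := fun α h => hl α (by simp [h])
      have h1 := h β hβ.1
      rw [List.map_append, List.prod_append, List.map_singleton, List.prod_singleton] at *
      rw [LinearEquiv.mul_apply, ctx.reflV_self (ctx.simple_root hβ), map_neg] at h1
      obtain ⟨l', hl', hlen, heq⟩ := ctx.exchange hβ t ht h1
      rw [heq] at h ⊢
      exact ih l'.length (by simp at hn; omega) l' hl' h rfl

end RootSystemCtx

namespace RootSystemCtx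

variable {V : Type*} [AddCommGroup V] [Module ℚ V] (ctx : RootSystemCtx V)

/-- `u` acts on `V̂` as translation by `y` followed by `g`. -/
def IsAff (u : (V × ℚ × ℚ) ≃ₗ[ℚ] (V × ℚ × ℚ)) (g : V ≃ₗ[ℚ] V) (y : V) : Prop :=
  ∀ (v : V) (a b : ℚ), u (v, a, b) = (g (v - b • y), a + ctx.B y v - b * (ctx.B y y / 2), b)

variable {ctx}

lemma IsAff.unique {u u' : (V × ℚ × ℚ) ≃ₗ[ℚ] (V × ℚ × ℚ)} {g : V ≃ₗ[ℚ] V} {y : V}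
    (h : ctx.IsAff u g y) (h' : ctx.IsAff u' g y) : u = u' := by
  refine LinearEquiv.ext fun ⟨v, a, b⟩ => ?_
  rw [h, h']

lemma IsAff.apply {u : (V × ℚ × ℚ) ≃ₗ[ℚ] (V × ℚ × ℚ)} {g : V ≃ₗ[ℚ] V} {y : V}
    (h : ctx.IsAff u g y) (v : V) (a : ℚ) : u (v, a, 0) = (g v, a + ctx.B y v, 0) := by
  rw [h]; simp

lemma IsAff.one : ctx.IsAff 1 1 0 := fun v a b => by simp

lemma IsAff.mul {u u' : (V × ℚ × ℚ) ≃ₗ[ℚ] (V × ℚ × ℚ)} {g g' : V ≃ₗ[ℚ] V} {y y' : V}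
    (hg' : g' ∈ ctx.weyl) (h : ctx.IsAff u g y) (h' : ctx.IsAff u' g' y') :
    ctx.IsAff (u * u') (g * g') (y' + g'⁻¹ y) := by
  intro v a b
  have e : g' (g'⁻¹ y) = y := by simp
  have h1 := ctx.weyl_inv_adjoint hg' y v
  have h2 := ctx.weyl_inv_adjoint hg' y y'
  have h3 : ctx.B (g'⁻¹ y) (g'⁻¹ y) = ctx.B y y := by rw [ctx.weyl_inv_adjoint hg', e]
  rw [LinearEquiv.mul_apply, h', h]
  simp only [Prod.mk.injEq, and_true]
  refine ⟨?_, ?_⟩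
  · rw [LinearEquiv.mul_apply]
    congr 1
    simp only [map_sub, map_smul, map_add, e, smul_add]
    abel
  · simp only [map_sub, map_smul, map_add, LinearMap.add_apply, smul_eq_mul, h1, h2, h3,
      ctx.B_symm y' (g'⁻¹ y)]
    ring

lemma IsAff.inv {u : (V × ℚ × ℚ) ≃ₗ[ℚ] (V × ℚ × ℚ)} {g : V ≃ₗ[ℚ] V} {y : V}
    (hg : g ∈ ctx.weyl) (h : ctx.IsAff u g y) : ctx.IsAff u⁻¹ g⁻¹ (-g y) := by
  intro v a b
  apply u.injective
  rw [← LinearEquiv.mul_apply, mul_inv_cancel, h, LinearEquiv.coe_one, id]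
  have e : g⁻¹ (g y) = y := by simp
  have e' : g (g⁻¹ v) = v := by simp
  have h1 : ctx.B y (g⁻¹ v) = ctx.B (g y) v := by rw [← ctx.weyl_isometry hg, e']
  simp only [map_sub, map_smul, map_neg, map_add, smul_neg, sub_neg_eq_add, LinearMap.neg_apply,
    smul_eq_mul, h1, e, e', ctx.weyl_isometry hg, Prod.mk.injEq, and_true, neg_neg]
  constructor
  · abel
  · ring

variable (ctx)

lemma isAff_refl {α : V} (hα : α ∈ ctx.Δ) (k : ℚ) :
    ctx.IsAff (ctx.refl (α, k, 0)) (ctx.reflV α) (-(k • ctx.coroot α)) := by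
  intro v a b
  have h := (ctx.norm_pos hα).ne'
  have hB : ctx.Bhat (α, k, 0) (α, k, 0) = ctx.B α α := by simp [Bhat]
  have hB' : ctx.Bhat (α, k, 0) (v, a, b) = ctx.B v α + k * b := by
    simp [Bhat, ctx.B_symm α v]
  have hc : ctx.reflV α (ctx.coroot α) = -ctx.coroot α := by
    rw [coroot, map_smul, ctx.reflV_self hα, smul_neg]
  rw [refl, dif_neg (by rw [hB]; exact h), Module.reflection_apply, LinearMap.smul_apply, hB, hB']
  simp only [Prod.smul_mk, Prod.mk_sub_mk, Prod.mk.injEq, smul_eq_mul, mul_zero, sub_zero,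
    and_true]
  refine ⟨?_, ?_⟩
  · rw [map_sub, map_smul, map_neg, map_smul, hc, ctx.reflV_apply hα, coroot]
    match_scalars <;> ring
  · simp only [coroot, map_neg, map_smul, LinearMap.neg_apply, LinearMap.smul_apply, smul_eq_mul,
      ctx.B_symm α v]
    field_simp
    ring

lemma exists_isAff {u : (V × ℚ × ℚ) ≃ₗ[ℚ] (V × ℚ × ℚ)} (hu : u ∈ ctx.What) :
    ∃ g ∈ ctx.weyl, ∃ y ∈ ctx.corootLattice, ctx.IsAff u g y := by
  rw [What] at hu
  induction hu using Subgroup.closure_induction with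
  | mem u hu =>
    obtain ⟨β, ⟨α, hα, k, rfl⟩, rfl⟩ := hu
    refine ⟨_, ctx.reflV_mem_weyl hα, _, ?_, ctx.isAff_refl hα k⟩
    rw [Int.cast_smul_eq_zsmul]
    exact neg_mem (zsmul_mem (ctx.coroot_mem hα) k)
  | one => exact ⟨1, one_mem _, 0, zero_mem _, IsAff.one⟩
  | mul u u' _ _ h h' =>
    obtain ⟨g, hg, y, hy, h⟩ := h
    obtain ⟨g', hg', y', hy', h'⟩ := h'
    exact ⟨_, mul_mem hg hg', _,
      add_mem hy' (ctx.weyl_corootLattice (inv_mem hg') hy), h.mul hg' h'⟩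
  | inv u _ h =>
    obtain ⟨g, hg, y, hy, h⟩ := h
    exact ⟨_, inv_mem hg, _, neg_mem (ctx.weyl_corootLattice hg hy), h.inv hg⟩

lemma exists_isAff_zero_of_mem_Wfin {u : (V × ℚ × ℚ) ≃ₗ[ℚ] (V × ℚ × ℚ)} (hu : u ∈ ctx.Wfin) :
    ∃ g ∈ ctx.weyl, ctx.IsAff u g 0 := by
  rw [Wfin] at hu
  induction hu using Subgroup.closure_induction with
  | mem u hu =>
    obtain ⟨α, hα, rfl⟩ := hu
    exact ⟨_, ctx.reflV_mem_weyl hα, by simpa using ctx.isAff_refl hα 0⟩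
  | one => exact ⟨1, one_mem _, IsAff.one⟩
  | mul u u' _ _ h h' =>
    obtain ⟨g, hg, h⟩ := h
    obtain ⟨g', hg', h'⟩ := h'
    exact ⟨_, mul_mem hg hg', by simpa using h.mul hg' h'⟩
  | inv u _ h =>
    obtain ⟨g, hg, h⟩ := h
    exact ⟨_, inv_mem hg, by simpa using h.inv hg⟩

lemma exists_mem_Wfin_of_mem_weyl {g : V ≃ₗ[ℚ] V} (hg : g ∈ ctx.weyl) :
    ∃ u ∈ ctx.Wfin, ctx.IsAff u g 0 := by
  induction hg using Subgroup.closure_induction with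
  | mem g hg =>
    obtain ⟨α, hα, rfl⟩ := hg
    exact ⟨_, Subgroup.subset_closure ⟨α, hα, rfl⟩, by simpa using ctx.isAff_refl hα 0⟩
  | one => exact ⟨1, one_mem _, IsAff.one⟩
  | mul g g' _ hg' h h' =>
    obtain ⟨u, hu, h⟩ := h
    obtain ⟨u', hu', h'⟩ := h'
    exact ⟨_, mul_mem hu hu', by simpa using h.mul hg' h'⟩
  | inv g hg h =>
    obtain ⟨u, hu, h⟩ := h
    exact ⟨_, inv_mem hu, by simpa using h.inv hg⟩

lemma theta_root : ctx.θ ∈ ctx.Δ := ctx.pos_subset ctx.θ_pos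

lemma isAff_refl_alpha0 :
    ctx.IsAff (ctx.refl ctx.alpha0) (ctx.reflV ctx.θ) (ctx.coroot ctx.θ) := by
  have := ctx.isAff_refl (ctx.neg_mem_Δ _ ctx.theta_root) 1
  rwa [ctx.reflV_neg ctx.theta_root, coroot_neg, one_smul, neg_neg] at this

lemma refl_mul_self {α : V} (hα : α ∈ ctx.Δ) (k : ℚ) :
    ctx.refl (α, k, 0) * ctx.refl (α, k, 0) = 1 := by
  have h := ctx.isAff_refl hα k
  have h2 := h.mul (ctx.reflV_mem_weyl hα) h
  rw [ctx.reflV_mul_self hα, ctx.reflV_inv hα, map_neg, map_smul, coroot, map_smul,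
    ctx.reflV_self hα] at h2
  refine IsAff.unique h2 ?_
  convert IsAff.one (ctx := ctx) using 1
  module

lemma refl_mem_What {α : V} (hα : α ∈ ctx.Δ) (k : ℤ) : ctx.refl (α, (k : ℚ), 0) ∈ ctx.What :=
  Subgroup.subset_closure ⟨_, ⟨α, hα, k, rfl⟩, rfl⟩

lemma alpha0_eq : ctx.alpha0 = (-ctx.θ, ((1 : ℤ) : ℚ), 0) := by simp [alpha0]

lemma δhat_sub_emb (γ : V) : ctx.δhat - ctx.emb γ = (-γ, ((1 : ℤ) : ℚ), 0) := by
  simp [δhat, emb]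

lemma mem_posHat {α : V} {k : ℤ} :
    (α, (k : ℚ), (0 : ℚ)) ∈ ctx.PosHat ↔ α ∈ ctx.Δ ∧ (1 ≤ k ∨ k = 0 ∧ α ∈ ctx.Pos) := by
  constructor
  · rintro (⟨β, hβ, h⟩ | ⟨β, hβ, j, hj, h⟩)
    · simp only [Prod.mk.injEq, and_true, Int.cast_eq_zero] at h
      obtain ⟨rfl, rfl⟩ := h
      exact ⟨ctx.pos_subset hβ, Or.inr ⟨rfl, hβ⟩⟩
    · simp only [Prod.mk.injEq, and_true, Int.cast_inj] at h
      obtain ⟨rfl, rfl⟩ := h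
      exact ⟨hβ, Or.inl hj⟩
  · rintro ⟨hα, h | ⟨rfl, h⟩⟩
    · exact Or.inr ⟨α, hα, k, h, rfl⟩
    · exact Or.inl ⟨α, h, by simp⟩

lemma exists_of_mem_posHat {x : V × ℚ × ℚ} (hx : x ∈ ctx.PosHat) :
    ∃ α ∈ ctx.Δ, ∃ k : ℤ, 0 ≤ k ∧ x = (α, (k : ℚ), 0) := by
  rcases hx with ⟨α, hα, rfl⟩ | ⟨α, hα, k, hk, rfl⟩
  · exact ⟨α, ctx.pos_subset hα, 0, le_rfl, by simp⟩
  · exact ⟨α, hα, k, by omega, rfl⟩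

lemma neg_mk {V : Type*} [AddCommGroup V] (α : V) (k : ℤ) : -(α, (k : ℚ), (0 : ℚ)) = (-α, ((-k : ℤ) : ℚ), 0) := by simp

lemma posHat_or_neg {x : V × ℚ × ℚ} (hx : x ∈ ctx.Δhat) :
    x ∈ ctx.PosHat ∨ -x ∈ ctx.PosHat := by
  obtain ⟨α, hα, k, rfl⟩ := hx
  have hα' := ctx.neg_mem_Δ α hα
  rw [neg_mk, mem_posHat, mem_posHat]
  rcases ctx.mem_pos_or_neg_pos α hα with h | h <;> rcases lt_trichotomy k 0 with h' | h' | h'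
  · exact Or.inr ⟨hα', Or.inl (by omega)⟩
  · exact Or.inl ⟨hα, Or.inr ⟨h', h⟩⟩
  · exact Or.inl ⟨hα, Or.inl h'⟩
  · exact Or.inr ⟨hα', Or.inl (by omega)⟩
  · exact Or.inr ⟨hα', Or.inr ⟨by omega, h⟩⟩
  · exact Or.inl ⟨hα, Or.inl h'⟩

lemma posHat_not_neg {x : V × ℚ × ℚ} (hx : x ∈ ctx.PosHat) : -x ∉ ctx.PosHat := by
  obtain ⟨α, hα, k, hk, rfl⟩ := ctx.exists_of_mem_posHat hx
  rw [neg_mk, mem_posHat]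
  rintro ⟨-, h | ⟨h, h'⟩⟩
  · omega
  · rcases ((ctx.mem_posHat).mp hx).2 with h1 | ⟨-, h1⟩
    · omega
    · exact ctx.pos_not_neg α h1 h'

lemma posHat_add_nsmul {x y : V × ℚ × ℚ} (hx : x ∈ ctx.PosHat) (hy : y ∈ ctx.PosHat) (n : ℕ)
    (h : x + n • y ∈ ctx.Δhat) : x + n • y ∈ ctx.PosHat := by
  obtain ⟨α, hα, j, hj, rfl⟩ := ctx.exists_of_mem_posHat hx
  obtain ⟨β, hβ, k, hk, rfl⟩ := ctx.exists_of_mem_posHat hy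
  rw [mem_posHat] at hx hy
  have e : (α, (j : ℚ), (0 : ℚ)) + n • (β, (k : ℚ), (0 : ℚ)) =
      (α + n • β, ((j + n * k : ℤ) : ℚ), 0) := by simp
  rw [e] at h ⊢
  obtain ⟨γ, hγ, m, hm⟩ := h
  obtain ⟨rfl, -⟩ := Prod.mk.inj hm
  rw [mem_posHat]
  refine ⟨hγ, ?_⟩
  have hnk : 0 ≤ (n : ℤ) * k := by positivity
  by_cases h1 : 1 ≤ j + n * k
  · exact Or.inl h1
  · have hj0 : j = 0 := by omega
    have hnk0 : (n : ℤ) * k = 0 := by omega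
    refine Or.inr ⟨by omega, ?_⟩
    have hα' : α ∈ ctx.Pos := by
      rcases hx.2 with h | h
      · omega
      · exact h.2
    refine ctx.pos_of_mem_closure hγ (add_mem (AddSubmonoid.subset_closure hα') ?_)
    rcases mul_eq_zero.mp hnk0 with h | h
    · have : n = 0 := by exact_mod_cast h
      simp [this]
    · have hβ' : β ∈ ctx.Pos := by
        rcases hy.2 with h | h
        · omega
        · exact h.2
      exact AddSubmonoid.nsmul_mem _ (AddSubmonoid.subset_closure hβ') n

lemma posHat_subset {x : V × ℚ × ℚ} (hx : x ∈ ctx.PosHat) : x ∈ ctx.Δhat := by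
  obtain ⟨α, hα, k, -, rfl⟩ := ctx.exists_of_mem_posHat hx
  exact ⟨α, hα, k, rfl⟩

lemma What_mem_Δhat {u : (V × ℚ × ℚ) ≃ₗ[ℚ] (V × ℚ × ℚ)} (hu : u ∈ ctx.What) {x : V × ℚ × ℚ}
    (hx : x ∈ ctx.Δhat) : u x ∈ ctx.Δhat := by
  obtain ⟨g, hg, y, hy, h⟩ := ctx.exists_isAff hu
  obtain ⟨α, hα, k, rfl⟩ := hx
  obtain ⟨n, hn⟩ := ctx.corootLattice_pairing hy hα
  exact ⟨g α, ctx.weyl_mem hg α hα, k + n, by rw [h.apply, hn]; push_cast; rfl⟩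

section Minuscule

variable {w : (V × ℚ × ℚ) ≃ₗ[ℚ] (V × ℚ × ℚ)} {g : V ≃ₗ[ℚ] V} {y : V}

variable {ctx}

lemma IsAff.neg_apply_mem_posHat (hg : g ∈ ctx.weyl) (h : ctx.IsAff w g y) {α : V} (hα : α ∈ ctx.Δ)
    (k : ℤ) {n : ℤ} (hn : ctx.B y α = n) :
    -(w (α, (k : ℚ), 0)) ∈ ctx.PosHat ↔ k + n ≤ -1 ∨ k + n = 0 ∧ -g α ∈ ctx.Pos := by
  have hg' := ctx.neg_mem_Δ _ (ctx.weyl_mem hg α hα)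
  rw [h.apply, hn, ← Int.cast_add, neg_mk, mem_posHat]
  simp only [hg', true_and, neg_eq_zero]
  rw [show (1 ≤ -(k + n) ↔ k + n ≤ -1) by omega]

lemma IsMinuscule.not_mem_nhat (hw : ctx.IsMinuscule w) {α : V} {k : ℤ} (hk : k ≠ 1)
    (hα : (α, (k : ℚ), (0 : ℚ)) ∈ ctx.PosHat) : -(w (α, (k : ℚ), 0)) ∉ ctx.PosHat := by
  intro h
  obtain ⟨γ, -, hγ⟩ := hw.2 _ ⟨hα, h⟩
  rw [δhat_sub_emb, Prod.mk.injEq, Prod.mk.injEq, Int.cast_inj] at hγ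
  exact hk hγ.2.1

lemma IsMinuscule.pairing_nonneg (hw : ctx.IsMinuscule w) (hg : g ∈ ctx.weyl)
    (h : ctx.IsAff w g y) {α : V} (hα : α ∈ ctx.Pos) {n : ℤ} (hn : ctx.B y α = n) :
    0 ≤ n ∧ (n = 0 → g α ∈ ctx.Pos) := by
  have hαΔ := ctx.pos_subset hα
  have h1 := hw.not_mem_nhat (k := 0) (by norm_num)
    (ctx.mem_posHat.mpr ⟨hαΔ, Or.inr ⟨rfl, hα⟩⟩)
  rw [h.neg_apply_mem_posHat hg hαΔ 0 hn] at h1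
  push Not at h1
  refine ⟨by omega, fun h0 => ?_⟩
  exact (ctx.mem_pos_or_neg_pos _ (ctx.weyl_mem hg α hαΔ)).resolve_right (h1.2 (by omega))

lemma IsMinuscule.pairing_le_two (hw : ctx.IsMinuscule w) (hg : g ∈ ctx.weyl)
    (h : ctx.IsAff w g y) {α : V} (hα : α ∈ ctx.Pos) {n : ℤ} (hn : ctx.B y α = n) :
    n ≤ 2 := by
  have hαΔ := ctx.neg_mem_Δ _ (ctx.pos_subset hα)
  have h1 := hw.not_mem_nhat (k := 2) (by norm_num)
    (ctx.mem_posHat.mpr ⟨hαΔ, Or.inl (by norm_num)⟩)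
  rw [h.neg_apply_mem_posHat hg hαΔ 2 (n := -n) (by simp [hn])] at h1
  push Not at h1
  omega

lemma IsAff.mem_idealOf (hg : g ∈ ctx.weyl) (h : ctx.IsAff w g y) {α : V} (hα : α ∈ ctx.Pos)
    {n : ℤ} (hn : ctx.B y α = n) :
    α ∈ ctx.idealOf w ↔ 2 ≤ n ∨ n = 1 ∧ g α ∈ ctx.Pos := by
  have hαΔ := ctx.neg_mem_Δ _ (ctx.pos_subset hα)
  have h1 := h.neg_apply_mem_posHat hg hαΔ 1 (n := -n) (by simp [hn])
  have h2 : (-α, ((1 : ℤ) : ℚ), (0 : ℚ)) ∈ ctx.PosHat := ctx.mem_posHat.mpr ⟨hαΔ, Or.inl le_rfl⟩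
  rw [idealOf, Set.mem_ofPred_eq, Nhat, Set.mem_ofPred_eq, δhat_sub_emb, h1, map_neg, neg_neg]
  simp only [hα, h2, true_and]
  rw [show (1 + -n ≤ -1 ↔ 2 ≤ n) by omega, show (1 + -n = 0 ↔ n = 1) by omega]

lemma IsMinuscule.pairing_theta (hw : ctx.IsMinuscule w) (hne : (ctx.idealOf w).Nonempty)
    (hg : g ∈ ctx.weyl) (hy : y ∈ ctx.corootLattice) (h : ctx.IsAff w g y) :
    ctx.B y ctx.θ = 2 := by
  have hnn : ∀ p ∈ AddSubmonoid.closure ctx.Pos, 0 ≤ ctx.B y p := by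
    intro p hp
    induction hp using AddSubmonoid.closure_induction with
    | mem p hp =>
      obtain ⟨n, hn⟩ := ctx.corootLattice_pairing hy (ctx.pos_subset hp)
      rw [hn]
      exact_mod_cast (hw.pairing_nonneg hg h hp hn).1
    | zero => simp
    | add p q _ _ hp hq => rw [map_add]; exact add_nonneg hp hq
  have hle : ∀ α ∈ ctx.Δ, ctx.B y α ≤ ctx.B y ctx.θ := by
    intro α hα
    have := hnn _ (ctx.θ_highest α hα)
    rw [map_sub] at this
    linarith
  obtain ⟨n, hn⟩ := ctx.corootLattice_pairing hy ctx.theta_root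
  have h2 := hw.pairing_le_two hg h ctx.θ_pos hn
  have h1 : 1 ≤ n := by
    obtain ⟨γ, hγ⟩ := hne
    obtain ⟨m, hm⟩ := ctx.corootLattice_pairing hy (ctx.pos_subset hγ.1)
    have h3 := hle γ (ctx.pos_subset hγ.1)
    rw [hm, hn] at h3
    have h3 : m ≤ n := by exact_mod_cast h3
    rcases (h.mem_idealOf hg hγ.1 hm).mp hγ with h4 | h4 <;> omega
  have hn1 : n ≠ 1 := by
    rintro rfl
    have := ctx.eq_zero_of_pairing_le_one hy fun β hβ => (hle β hβ).trans (by simp [hn])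
    rw [this] at hn
    simp at hn
  obtain rfl : n = 2 := by omega
  simpa using hn

lemma IsMinuscule.theta_mem (hw : ctx.IsMinuscule w) (hne : (ctx.idealOf w).Nonempty) :
    ctx.θ ∈ ctx.idealOf w := by
  obtain ⟨g, hg, y, hy, h⟩ := ctx.exists_isAff hw.1
  exact (h.mem_idealOf hg ctx.θ_pos (n := 2)
    (by simpa using hw.pairing_theta hne hg hy h)).mpr (Or.inl le_rfl)

lemma idealOf_pairing_pos {w' : (V × ℚ × ℚ) ≃ₗ[ℚ] (V × ℚ × ℚ)} (hw' : w' ∈ ctx.Wfin) {γ : V}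
    (hγ : γ ∈ ctx.idealOf (w' * ctx.refl ctx.alpha0)) : 0 < ctx.B γ ctx.θ := by
  obtain ⟨g, hg, h⟩ := ctx.exists_isAff_zero_of_mem_Wfin hw'
  have hθ := ctx.reflV_mem_weyl ctx.theta_root
  have h' := h.mul hθ ctx.isAff_refl_alpha0
  rw [map_zero, add_zero] at h'
  obtain ⟨n, hn⟩ := ctx.coroot_pairing ctx.theta_root (ctx.pos_subset hγ.1)
  have h1 := (h'.mem_idealOf (mul_mem hg hθ) hγ.1 hn).mp hγ
  have h2 : (0 : ℚ) < n := by
    have : 0 < n := by omega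
    exact_mod_cast this
  have := ctx.norm_pos ctx.theta_root
  rw [← hn, coroot, map_smul, LinearMap.smul_apply, smul_eq_mul, ctx.B_symm ctx.θ γ] at h2
  exact pos_of_mul_pos_right h2 (by positivity)

lemma IsMinuscule.exists_mul_refl (hw : ctx.IsMinuscule w) (hne : (ctx.idealOf w).Nonempty)
    (hI : ∀ γ ∈ ctx.idealOf w, 0 < ctx.B γ ctx.θ) :
    ∃ w' ∈ ctx.Wfin, w = w' * ctx.refl ctx.alpha0 := by
  obtain ⟨g, hg, y, hy, h⟩ := ctx.exists_isAff hw.1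
  have hθ := ctx.reflV_mem_weyl ctx.theta_root
  have h' := h.mul hθ ctx.isAff_refl_alpha0
  have hyθ := hw.pairing_theta hne hg hy h
  rw [ctx.reflV_inv ctx.theta_root] at h'
  set z := ctx.coroot ctx.θ + ctx.reflV ctx.θ y with hz
  have hzm : z ∈ ctx.corootLattice :=
    add_mem (ctx.coroot_mem ctx.theta_root) (ctx.weyl_corootLattice hθ hy)
  have hpair : ∀ β, ctx.B z β = ctx.B y β - 2 * ctx.B β ctx.θ / ctx.B ctx.θ ctx.θ := by
    intro β
    have := (ctx.norm_pos ctx.theta_root).ne'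
    rw [hz, ctx.reflV_apply ctx.theta_root, coroot]
    simp only [map_add, map_sub, map_smul, LinearMap.add_apply, LinearMap.sub_apply,
      LinearMap.smul_apply, smul_eq_mul, ctx.B_symm ctx.θ β, hyθ]
    field_simp
    ring
  have hpos : ∀ α ∈ ctx.Pos, -1 ≤ ctx.B z α ∧ ctx.B z α ≤ 1 := by
    intro α hα
    have ht := (ctx.norm_pos ctx.theta_root).ne'
    by_cases hαθ : α = ctx.θ
    · rw [hpair, hαθ, hyθ, mul_div_assoc, div_self ht]
      norm_num
    obtain ⟨n, hn⟩ := ctx.corootLattice_pairing hy (ctx.pos_subset hα)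
    have h0 := (hw.pairing_nonneg hg h hα hn).1
    rcases RootSystemCtx.pairing_theta ctx hα hαθ with h1 | h1
    · have hnot : α ∉ ctx.idealOf w := fun hm => by
        have h2 := hI α hm
        have := ctx.norm_pos ctx.theta_root
        have : 0 < 2 * ctx.B α ctx.θ / ctx.B ctx.θ ctx.θ := by positivity
        linarith
      rw [h.mem_idealOf hg hα hn] at hnot
      push Not at hnot
      have h3 : n ≤ 1 := by omega
      rw [hpair, h1, hn]
      have h0 : (0 : ℚ) ≤ n := by exact_mod_cast h0
      have h3 : (n : ℚ) ≤ 1 := by exact_mod_cast h3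
      constructor <;> linarith
    · have h3 := hw.pairing_le_two hg h hα hn
      rw [hpair, h1, hn]
      have h0 : (0 : ℚ) ≤ n := by exact_mod_cast h0
      have h3 : (n : ℚ) ≤ 2 := by exact_mod_cast h3
      constructor <;> linarith
  have hz0 : z = 0 := ctx.eq_zero_of_pairing_le_one hzm fun β hβ => by
    rcases ctx.mem_pos_or_neg_pos β hβ with h1 | h1
    · exact (hpos β h1).2
    · have := (hpos _ h1).1
      rw [map_neg] at this
      linarith
  rw [hz0] at h'
  obtain ⟨u, hu, hu'⟩ := ctx.exists_mem_Wfin_of_mem_weyl (mul_mem hg hθ)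
  refine ⟨u, hu, ?_⟩
  rw [← h'.unique hu', mul_assoc, alpha0_eq,
    ctx.refl_mul_self (ctx.neg_mem_Δ _ ctx.theta_root), mul_one]

/-- Removing from the ideal a minimal root orthogonal to `θ`. -/
lemma IsMinuscule.remove_orthogonal (hw : ctx.IsMinuscule w) {γ : V} (hγ : γ ∈ ctx.idealOf w)
    (hmin : ∀ γ' ∈ ctx.idealOf w, ∀ β ∈ ctx.Pos, γ ≠ γ' + β) :
    ctx.IsMinuscule (w * ctx.refl (-γ, ((1 : ℤ) : ℚ), 0)) ∧
      ctx.Nhat (w * ctx.refl (-γ, ((1 : ℤ) : ℚ), 0)) ⊆ ctx.Nhat w ∧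
      γ ∉ ctx.idealOf (w * ctx.refl (-γ, ((1 : ℤ) : ℚ), 0)) := by
  have hγΔ := ctx.pos_subset hγ.1
  have hγΔ' := ctx.neg_mem_Δ _ hγΔ
  set ξ : V × ℚ × ℚ := (-γ, ((1 : ℤ) : ℚ), 0) with hξ
  have hξN : ξ ∈ ctx.Nhat w := by
    have := hγ.2
    rwa [δhat_sub_emb] at this
  have hs : ctx.refl ξ ∈ ctx.What := ctx.refl_mem_What hγΔ' 1
  have haff := ctx.isAff_refl hγΔ' ((1 : ℤ) : ℚ)
  have hrefl : ∀ α ∈ ctx.Δ, ∀ k : ℤ, ∃ m : ℤ,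
      ctx.refl ξ (α, (k : ℚ), 0) = (α, (k : ℚ), 0) - m • ξ := by
    intro α hα k
    obtain ⟨m, hm⟩ := ctx.crystallographic α hα _ hγΔ'
    refine ⟨m, ?_⟩
    rw [hξ, haff.apply, ctx.reflV_apply hγΔ', hm, ← Int.cast_smul_eq_zsmul ℚ, coroot]
    simp only [Prod.smul_mk, Prod.mk_sub_mk, smul_eq_mul, mul_zero, sub_zero, Prod.mk.injEq,
      and_true, true_and, map_neg, map_smul, LinearMap.neg_apply, LinearMap.smul_apply] at hm ⊢
    rw [← hm, ctx.B_symm γ α]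
    push_cast
    ring
  have hsub : ctx.Nhat (w * ctx.refl ξ) ⊆ ctx.Nhat w := by
    rintro β ⟨hβ, hneg⟩
    refine ⟨hβ, ?_⟩
    rcases ctx.posHat_or_neg (ctx.What_mem_Δhat hw.1 (ctx.posHat_subset hβ)) with hpos | h
    swap
    · exact h
    exfalso
    obtain ⟨α, hα, k, hk, rfl⟩ := ctx.exists_of_mem_posHat hβ
    obtain ⟨m, hm⟩ := hrefl α hα k
    have hΔ := ctx.What_mem_Δhat hs (ctx.posHat_subset hβ)
    have hwΔ := ctx.What_mem_Δhat hw.1 hΔ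
    rw [LinearEquiv.mul_apply] at hneg
    rcases le_or_gt 0 m with h0 | h0
    · obtain ⟨d, rfl⟩ := Int.eq_ofNat_of_zero_le h0
      have e : w (ctx.refl ξ (α, (k : ℚ), 0)) = w (α, (k : ℚ), 0) + d • (-(w ξ)) := by
        rw [hm, map_sub, natCast_zsmul, map_nsmul, smul_neg, sub_eq_add_neg]
      rw [e] at hneg hwΔ
      exact ctx.posHat_not_neg (ctx.posHat_add_nsmul hpos hξN.2 d hwΔ) hneg
    · obtain ⟨d, hd⟩ := Int.eq_ofNat_of_zero_le (show 0 ≤ -m by omega)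
      obtain rfl : m = -d := by omega
      rw [neg_smul, sub_neg_eq_add, natCast_zsmul] at hm
      rw [hm] at hΔ hneg
      obtain ⟨γ', hγ', heq⟩ := hw.2 _ ⟨ctx.posHat_add_nsmul hβ hξN.1 d hΔ, hneg⟩
      have hmem : γ' ∈ ctx.idealOf w :=
        ⟨hγ', by rw [← heq]; exact ⟨ctx.posHat_add_nsmul hβ hξN.1 d hΔ, hneg⟩⟩
      rw [δhat_sub_emb, hξ] at heq
      simp only [Prod.smul_mk, Prod.mk_add_mk, Prod.mk.injEq] at heq
      obtain ⟨h1, h2, -⟩ := heq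
      have h2 : k + d = 1 := by
        have : ((k + d : ℤ) : ℚ) = 1 := by push_cast; simpa using h2
        exact_mod_cast this
      obtain rfl : d = 1 := by omega
      obtain rfl : k = 0 := by omega
      have hαp : α ∈ ctx.Pos := by
        rcases (ctx.mem_posHat.mp hβ).2 with h | h
        · omega
        · exact h.2
      refine hmin γ' hmem α hαp ?_
      rw [← neg_neg γ', ← h1]
      module
  refine ⟨⟨mul_mem hw.1 hs, fun β hβ => hw.2 β (hsub hβ)⟩, hsub, fun hmem => ?_⟩
  have h1 := hmem.2.2
  have h2 : ctx.refl ξ ξ = -ξ := by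
    have hc : ctx.B (ctx.coroot (-γ)) (-γ) = 2 := by
      have := (ctx.norm_pos hγΔ').ne'
      rw [coroot, map_smul, LinearMap.smul_apply, smul_eq_mul]; field_simp
    rw [hξ, haff.apply, ctx.reflV_self hγΔ']
    simp only [Prod.neg_mk, Prod.mk.injEq, map_neg, map_smul, LinearMap.neg_apply,
      LinearMap.smul_apply, smul_eq_mul, neg_zero, and_true, true_and] at hc ⊢
    push_cast
    linarith
  rw [δhat_sub_emb, ← hξ, LinearEquiv.mul_apply, h2, map_neg] at h1
  exact ctx.posHat_not_neg hξN.2 h1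

/-- Below every nonempty ideal there is one with the same rootlet, all of whose roots are
non-orthogonal to `θ`. -/
lemma IsMinuscule.exists_le (hw : ctx.IsMinuscule w) (hne : (ctx.idealOf w).Nonempty) :
    ∃ v, ctx.IsMinuscule v ∧ (ctx.idealOf v).Nonempty ∧ v ctx.alpha0 = w ctx.alpha0 ∧
      ctx.idealOf v ⊆ ctx.idealOf w ∧ ∀ γ ∈ ctx.idealOf v, 0 < ctx.B γ ctx.θ := by
  induction hn : (ctx.idealOf w).ncard using Nat.strong_induction_on generalizing w with
  | _ n ih =>
    by_cases hall : ∀ γ ∈ ctx.idealOf w, 0 < ctx.B γ ctx.θ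
    · exact ⟨w, hw, hne, rfl, subset_rfl, hall⟩
    have hmin : ∀ {α}, α ∈ ctx.Pos → (α ∈ ctx.idealOf w ∧ ctx.B α ctx.θ = 0) →
        ∃ γ ∈ ctx.idealOf w, ctx.B γ ctx.θ = 0 ∧
          ∀ γ' ∈ ctx.idealOf w, ∀ β ∈ ctx.Pos, γ ≠ γ' + β := by
      intro α hα
      refine ctx.pos_induction (P := fun α => (α ∈ ctx.idealOf w ∧ ctx.B α ctx.θ = 0) → _) ?_ hα
      rintro α hα ih ⟨hαI, hα0⟩
      by_cases hc : ∀ γ' ∈ ctx.idealOf w, ∀ β ∈ ctx.Pos, α ≠ γ' + β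
      · exact ⟨α, hαI, hα0, hc⟩
      push Not at hc
      obtain ⟨γ', hγ', β, hβ, rfl⟩ := hc
      rw [map_add, LinearMap.add_apply] at hα0
      have h1 := ctx.theta_dominant hγ'.1
      have h2 := ctx.theta_dominant hβ
      refine ih γ' hγ'.1 ?_ ?_ ⟨hγ', by linarith⟩
      · rw [add_sub_cancel_left]; exact AddSubmonoid.subset_closure hβ
      · simpa using ctx.ne_zero_of_mem (ctx.pos_subset hβ)
    push Not at hall
    obtain ⟨α, hα, hα0⟩ := hall
    obtain ⟨γ, hγ, hγ0, hγmin⟩ :=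
      hmin hα.1 ⟨hα, le_antisymm hα0 (ctx.theta_dominant hα.1)⟩
    obtain ⟨hv, hsub, hnot⟩ := hw.remove_orthogonal hγ hγmin
    set v := w * ctx.refl (-γ, ((1 : ℤ) : ℚ), 0) with hvdef
    have hv0 : v ctx.alpha0 = w ctx.alpha0 := by
      have hγΔ := ctx.neg_mem_Δ _ (ctx.pos_subset hγ.1)
      have haff := ctx.isAff_refl hγΔ ((1 : ℤ) : ℚ)
      rw [hvdef, LinearEquiv.mul_apply, alpha0_eq, haff.apply, ctx.reflV_apply hγΔ, coroot]
      simp [hγ0, ctx.B_symm ctx.θ γ]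
    have hI : ctx.idealOf v ⊆ ctx.idealOf w := fun α hα => ⟨hα.1, hsub hα.2⟩
    have hθ : ctx.θ ∈ ctx.idealOf v := by
      have h1 := hw.theta_mem hne
      have e : ctx.δhat - ctx.emb ctx.θ = ctx.alpha0 := by rw [δhat_sub_emb, alpha0_eq]
      refine ⟨ctx.θ_pos, h1.2.1, ?_⟩
      rw [e, hv0, ← e]
      exact h1.2.2
    have hlt : (ctx.idealOf v).ncard < n := by
      rw [← hn]
      exact Set.ncard_lt_ncard ⟨hI, fun h => hnot (h hγ)⟩
        (ctx.Δ_finite.subset fun α hα => ctx.pos_subset hα.1)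
    obtain ⟨u, hu, hune, hu0, huI, hupos⟩ := ih _ hlt hv ⟨_, hθ⟩ rfl
    exact ⟨u, hu, hune, hu0.trans hv0, huI.trans hI, hupos⟩

/-- A minuscule element of the form `w'·s₀` is determined by the image of `α₀`. -/
lemma IsMinuscule.eq_of_mul_refl {w' v' : (V × ℚ × ℚ) ≃ₗ[ℚ] (V × ℚ × ℚ)} (hw' : w' ∈ ctx.Wfin)
    (hv' : v' ∈ ctx.Wfin) (hw : ctx.IsMinuscule (w' * ctx.refl ctx.alpha0))
    (hv : ctx.IsMinuscule (v' * ctx.refl ctx.alpha0))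
    (h0 : (v' * ctx.refl ctx.alpha0) ctx.alpha0 = (w' * ctx.refl ctx.alpha0) ctx.alpha0) :
    v' = w' := by
  obtain ⟨a, ha, hwa⟩ := ctx.exists_isAff_zero_of_mem_Wfin hw'
  obtain ⟨b, hb, hvb⟩ := ctx.exists_isAff_zero_of_mem_Wfin hv'
  have hθ := ctx.reflV_mem_weyl ctx.theta_root
  have key : ∀ {u : (V × ℚ × ℚ) ≃ₗ[ℚ] (V × ℚ × ℚ)} {c : V ≃ₗ[ℚ] V}, c ∈ ctx.weyl →
      ctx.IsAff u c 0 → ctx.IsMinuscule (u * ctx.refl ctx.alpha0) →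
      ∀ α ∈ ctx.Pos, ctx.B α ctx.θ = 0 → c α ∈ ctx.Pos := by
    intro u c hc hu hum α hα hα0
    have h' := hu.mul hθ ctx.isAff_refl_alpha0
    rw [map_zero, add_zero] at h'
    have := (hum.pairing_nonneg (mul_mem hc hθ) h' hα (n := 0)
      (by simp [coroot, ctx.B_symm ctx.θ α, hα0])).2 rfl
    rw [LinearEquiv.mul_apply, ctx.reflV_apply ctx.theta_root, hα0] at this
    simpa using this
  have hab : b ctx.θ = a ctx.θ := by
    have e1 := hvb.mul hθ ctx.isAff_refl_alpha0
    have e2 := hwa.mul hθ ctx.isAff_refl_alpha0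
    rw [alpha0_eq] at h0 e1 e2
    rw [e1.apply, e2.apply] at h0
    have h1 := (Prod.mk.inj h0).1
    rw [LinearEquiv.mul_apply, LinearEquiv.mul_apply, map_neg, ctx.reflV_self ctx.theta_root,
      neg_neg] at h1
    exact h1
  have hz : a⁻¹ * b ∈ ctx.weyl := mul_mem (inv_mem ha) hb
  have hzθ : (a⁻¹ * b) ctx.θ = ctx.θ := by
    rw [LinearEquiv.mul_apply, hab]; simp
  have hone : a⁻¹ * b = 1 := by
    refine ctx.eq_one_of_preserves_pos hz fun α hα => ?_
    have hzα := ctx.weyl_mem hz α (ctx.pos_subset hα)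
    have hB : ctx.B ((a⁻¹ * b) α) ctx.θ = ctx.B α ctx.θ := by
      conv_lhs => rw [← hzθ]
      exact ctx.weyl_isometry hz α ctx.θ
    refine (ctx.mem_pos_or_neg_pos _ hzα).resolve_right fun hneg => ?_
    have h1 := ctx.theta_dominant hα
    have h2 := ctx.theta_dominant hneg
    rw [map_neg, LinearMap.neg_apply, hB] at h2
    have h3 : ctx.B α ctx.θ = 0 := by linarith
    have h4 := key ha hwa hw _ hneg (by rw [map_neg, LinearMap.neg_apply, hB, h3, neg_zero])
    rw [map_neg, LinearEquiv.mul_apply] at h4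
    refine ctx.pos_not_neg _ (key hb hvb hv α hα h3) ?_
    simpa using h4
  have : b = a := (inv_mul_eq_one.mp hone).symm
  rw [this] at hvb
  exact hvb.unique hwa

end Minuscule

end RootSystemCtx

/-- Theorem `H`: for a nontrivial minuscule `w`, the following
are equivalent: (i) `I_w` is the minimal element of `Ab_{τ(I_w)}`; (ii) every
root of `I_w` is non-orthogonal to `θ`; (iii) `w = w′·s₀` with `w′ ∈ W`. -/
theorem statement_16 {V : Type*} [AddCommGroup V] [Module ℚ V] (ctx : RootSystemCtx V)
    (w : (V × ℚ × ℚ) ≃ₗ[ℚ] (V × ℚ × ℚ)) (hw : ctx.IsMinuscule w)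
    (hne : (ctx.idealOf w).Nonempty) :
    ((∀ v : (V × ℚ × ℚ) ≃ₗ[ℚ] (V × ℚ × ℚ), ctx.IsMinuscule v →
          (ctx.idealOf v).Nonempty →
          v ctx.alpha0 + ctx.δhat = w ctx.alpha0 + ctx.δhat →
          ctx.idealOf w ⊆ ctx.idealOf v) ↔
        (∀ γ ∈ ctx.idealOf w, 0 < ctx.B γ ctx.θ)) ∧
    ((∀ γ ∈ ctx.idealOf w, 0 < ctx.B γ ctx.θ) ↔
        ∃ w' ∈ ctx.Wfin, w = w' * ctx.refl ctx.alpha0) := by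
  refine ⟨⟨fun h => ?_, fun h v hv hvne h0 => ?_⟩,
    fun h => hw.exists_mul_refl hne h, ?_⟩
  · obtain ⟨v, hv, hvne, h0, -, hpos⟩ := hw.exists_le hne
    exact fun γ hγ => hpos γ (h v hv hvne (by rw [h0]) hγ)
  · obtain ⟨u, hu, hune, hu0, huI, hpos⟩ := hv.exists_le hvne
    obtain ⟨w', hw', rfl⟩ := hw.exists_mul_refl hne h
    obtain ⟨u', hu', rfl⟩ := hu.exists_mul_refl hune hpos
    have := RootSystemCtx.IsMinuscule.eq_of_mul_refl hw' hu' hw hu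
      (hu0.trans (add_right_cancel h0))
    rwa [this] at huI
  · rintro ⟨w', hw', rfl⟩ γ hγ
    exact RootSystemCtx.idealOf_pairing_pos hw' hγ
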